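/- arXiv:2102.01328 — 3 statements merged into one kernel-verified Lean document; each statement's English description precedes it below -/
import Mathlib

section
/- (Time-varying peak-power, two states.) Let F* ∈ Ω₂. If there exist λ₁ ≥ 0 and λ₂ ≥ 0 such that for all (x₁, x₂) ∈ [0, A₁]×[0, A₂]: λ₁·(p₁·x₁² + p₂·x₂² − P) − λ₂·(p₁·ℰ(x₁) + p₂·ℰ(x₂) − E_req) + I(F*) − i(x₁, x₂; F*) ≥ 0, with equality for every (x₁, x₂) in the topological support of F*, then F* is optimal for the time-varying problem, i.e., I(F*) = sup_{F ∈ Ω₂} I(F). -/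
open MeasureTheory Real Set Filter

/-- Phase-removed Rayleigh-fading channel density `p(y|x)`. -/
noncomputable def pcond (x y : ℝ) : ℝ := (1 / (1 + x ^ 2)) * Real.exp (-y / (1 + x ^ 2))

/-- Modified Bessel function of the first kind, order zero. -/
noncomputable def besselI0 (t : ℝ) : ℝ := ∑' n : ℕ, (t ^ 2 / 4) ^ n / ((Nat.factorial n : ℝ)) ^ 2

/-- Harvested-energy function `ℰ(x) = I₀(√2 B h₂ x)`. -/
noncomputable def EH (B h2 x : ℝ) : ℝ := besselI0 (Real.sqrt 2 * B * h2 * x)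

/-- Output density `p(y; F)`. -/
noncomputable def pout (F : Measure ℝ) (y : ℝ) : ℝ := ∫ x, pcond x y ∂F

/-- Mutual-information density `i(x; F)`. -/
noncomputable def idens (F : Measure ℝ) (x : ℝ) : ℝ :=
  ∫ y in Set.Ioi (0 : ℝ), pcond x y * Real.log (pcond x y / pout F y)

/-- Mutual information `I(F)`. -/
noncomputable def MI (F : Measure ℝ) : ℝ := ∫ x, idens F x ∂F

/-- Borel probability measure concentrated on `[0, A]`. -/
def IsDistOn (A : ℝ) (F : Measure ℝ) : Prop :=
  IsProbabilityMeasure F ∧ F (Set.Icc 0 A)ᶜ = 0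

/-- The feasible set `Ω`: probability measures on `[0,A]` meeting the AP and EH constraints. -/
def Feas (A P B h2 Ereq : ℝ) (F : Measure ℝ) : Prop :=
  IsDistOn A F ∧ (∫ x, x ^ 2 ∂F) ≤ P ∧ Ereq ≤ ∫ x, EH B h2 x ∂F

/-- Information-energy capacity `C = sup_{F ∈ Ω} I(F)`. -/
noncomputable def Cap (A P B h2 Ereq : ℝ) : ℝ :=
  sSup (MI '' {F | Feas A P B h2 Ereq F})

/-- Topological support of a measure: points all of whose open neighborhoods have
positive measure (the smallest closed set of full measure). -/
def msupp {X : Type*} [TopologicalSpace X] [MeasurableSpace X] (μ : Measure X) : Set X :=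
  {x | ∀ U : Set X, IsOpen U → x ∈ U → 0 < μ U}

/-- Extended (Shannon-strategy) channel density `f(y|x₁,x₂) = p₁ p(y|x₁) + p₂ p(y|x₂)`. -/
noncomputable def fcond (p1 p2 : ℝ) (x : ℝ × ℝ) (y : ℝ) : ℝ :=
  p1 * pcond x.1 y + p2 * pcond x.2 y

/-- Output density `f(y; F)` of the extended channel. -/
noncomputable def fout (p1 p2 : ℝ) (F : Measure (ℝ × ℝ)) (y : ℝ) : ℝ :=
  ∫ x, fcond p1 p2 x y ∂F

/-- Mutual-information density `i(x₁, x₂; F)` of the extended channel. -/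
noncomputable def idens2 (p1 p2 : ℝ) (F : Measure (ℝ × ℝ)) (x : ℝ × ℝ) : ℝ :=
  ∫ y in Set.Ioi (0 : ℝ), fcond p1 p2 x y * Real.log (fcond p1 p2 x y / fout p1 p2 F y)

/-- Mutual information `I(F)` of the extended channel. -/
noncomputable def MI2 (p1 p2 : ℝ) (F : Measure (ℝ × ℝ)) : ℝ := ∫ x, idens2 p1 p2 F x ∂F

/-- Borel probability measure concentrated on `[0, A₁] × [0, A₂]`. -/
def IsDistOn2 (A1 A2 : ℝ) (F : Measure (ℝ × ℝ)) : Prop :=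
  IsProbabilityMeasure F ∧ F (Set.Icc 0 A1 ×ˢ Set.Icc 0 A2)ᶜ = 0

/-- The feasible set `Ω₂` for the time-varying peak-power problem. -/
def Feas2 (A1 A2 p1 p2 P B h2 Ereq : ℝ) (F : Measure (ℝ × ℝ)) : Prop :=
  IsDistOn2 A1 A2 F ∧ (∫ x : ℝ × ℝ, (p1 * x.1 ^ 2 + p2 * x.2 ^ 2) ∂F) ≤ P ∧
    Ereq ≤ ∫ x : ℝ × ℝ, (p1 * EH B h2 x.1 + p2 * EH B h2 x.2) ∂F

/-- Capacity `sup_{F ∈ Ω₂} I(F)` for the time-varying peak-power problem. -/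
noncomputable def Cap2 (A1 A2 p1 p2 P B h2 Ereq : ℝ) : ℝ :=
  sSup (MI2 p1 p2 '' {F | Feas2 A1 A2 p1 p2 P B h2 Ereq F})

/-- The interval of values that channel densities take at `y` when inputs are bounded. -/
def densityBand (c y : ℝ) : Set ℝ := Icc (c * exp (-y)) (exp (-(c * y)))

/-- The function of `y` dominating `t ↦ t * log (a / b)` over the density band. -/
noncomputable def bandEnvelope (c y : ℝ) : ℝ := exp (-(c * y)) * (y - log c)

lemma densityBand_pos {c y t : ℝ} (hc : 0 < c) (ht : t ∈ densityBand c y) : 0 < t :=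
  lt_of_lt_of_le (by positivity) ht.1

lemma abs_log_div_le_of_mem_densityBand {c y a b : ℝ} (hc : 0 < c) (hy : 0 < y)
    (ha : a ∈ densityBand c y) (hb : b ∈ densityBand c y) : |log (a / b)| ≤ y - log c := by
  have key : ∀ t ∈ densityBand c y, log c - y ≤ log t ∧ log t ≤ 0 := by
    intro t ht
    have ht0 := densityBand_pos hc ht
    refine ⟨?_, ?_⟩
    · have h := log_le_log (by positivity) ht.1
      rw [log_mul hc.ne' (exp_pos _).ne', log_exp] at h
      linarith
    · have h := log_le_log ht0 ht.2
      rw [log_exp] at h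
      nlinarith [mul_pos hc hy]
  rw [log_div (densityBand_pos hc ha).ne' (densityBand_pos hc hb).ne', abs_le]
  have h1 := key a ha
  have h2 := key b hb
  constructor <;> linarith

lemma integrableOn_bandEnvelope {c : ℝ} (hc : 0 < c) :
    IntegrableOn (bandEnvelope c) (Ioi 0) := by
  have h1 : IntegrableOn (fun y : ℝ => y * exp (-(c * y))) (Ioi 0) := by
    have h := integrableOn_rpow_mul_exp_neg_mul_rpow (p := 1) (s := 1) (b := c)
      (by norm_num) one_pos hc
    simpa using h
  have h2 : IntegrableOn (fun y : ℝ => log c * exp (-(c * y))) (Ioi 0) := by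
    have h := (integrableOn_exp_mul_Ioi (neg_lt_zero.mpr hc) 0).const_mul (log c)
    simpa [IntegrableOn] using h
  refine (h1.sub h2).congr ?_
  filter_upwards with y
  simp only [Pi.sub_apply, bandEnvelope]
  ring

lemma pcond_mem_densityBand {c x y : ℝ} (hy : 0 ≤ y) (hc : c ≤ 1 / (1 + x ^ 2)) :
    pcond x y ∈ densityBand c y := by
  have hx : (1 : ℝ) ≤ 1 + x ^ 2 := by nlinarith [sq_nonneg x]
  have h1 : 1 / (1 + x ^ 2) ≤ 1 := by
    rw [div_le_one (by linarith)]; exact hx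
  have hpos : 0 < 1 / (1 + x ^ 2) := by positivity
  have e : -y / (1 + x ^ 2) = -(1 / (1 + x ^ 2) * y) := by ring
  unfold pcond
  rw [e]
  generalize 1 / (1 + x ^ 2) = r at *
  constructor
  · have : exp (-y) ≤ exp (-(r * y)) := exp_le_exp.mpr (by nlinarith)
    exact mul_le_mul hc this (exp_pos _).le hpos.le
  · have : exp (-(r * y)) ≤ exp (-(c * y)) := exp_le_exp.mpr (by nlinarith)
    nlinarith [exp_pos (-(r * y))]

lemma exists_fcond_mem_densityBand (A1 A2 : ℝ) {p1 p2 : ℝ} (hp1 : 0 < p1) (hp2 : 0 < p2)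
    (hp : p1 + p2 = 1) : ∃ c > 0, ∀ x ∈ Icc (0 : ℝ) A1 ×ˢ Icc (0 : ℝ) A2, ∀ y : ℝ, 0 < y →
      fcond p1 p2 x y ∈ densityBand c y := by
  refine ⟨1 / (1 + (A1 ^ 2 + A2 ^ 2)), by positivity, ?_⟩
  rintro ⟨x1, x2⟩ ⟨h1, h2⟩ y hy
  simp only [mem_Icc] at h1 h2
  have m1 : pcond x1 y ∈ densityBand (1 / (1 + (A1 ^ 2 + A2 ^ 2))) y :=
    pcond_mem_densityBand hy.le
      (one_div_le_one_div_of_le (by positivity) (by nlinarith [sq_nonneg A2]))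
  have m2 : pcond x2 y ∈ densityBand (1 / (1 + (A1 ^ 2 + A2 ^ 2))) y :=
    pcond_mem_densityBand hy.le
      (one_div_le_one_div_of_le (by positivity) (by nlinarith [sq_nonneg A1]))
  exact convex_Icc _ _ m1 m2 hp1.le hp2.le hp

lemma continuous_fcond (p1 p2 : ℝ) :
    Continuous fun z : (ℝ × ℝ) × ℝ => fcond p1 p2 z.1 z.2 := by
  have h (x : ℝ) : 1 + x ^ 2 ≠ 0 := by positivity
  unfold fcond pcond
  fun_prop (disch := intros; apply h)

lemma measurable_fout (p1 p2 : ℝ) (F : Measure (ℝ × ℝ)) [SFinite F] :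
    Measurable (fout p1 p2 F) :=
  ((continuous_fcond p1 p2).stronglyMeasurable.integral_prod_left' (μ := F)).measurable

lemma integral_pcond (x : ℝ) : ∫ y in Ioi (0 : ℝ), pcond x y = 1 := by
  have hr : 0 < 1 / (1 + x ^ 2) := by positivity
  have e : ∀ y, pcond x y = 1 / (1 + x ^ 2) * exp (-(1 / (1 + x ^ 2)) * y) := by
    intro y; unfold pcond; congr 2; ring
  simp_rw [e]
  rw [integral_const_mul, integral_exp_mul_Ioi (neg_lt_zero.mpr hr)]
  simp only [mul_zero, exp_zero]
  field_simp

lemma integrableOn_pcond (x : ℝ) : IntegrableOn (pcond x) (Ioi (0 : ℝ)) := by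
  by_contra h
  exact zero_ne_one ((integral_undef h).symm.trans (integral_pcond x))

lemma integral_fcond {p1 p2 : ℝ} (hp : p1 + p2 = 1) (x : ℝ × ℝ) :
    ∫ y in Ioi (0 : ℝ), fcond p1 p2 x y = 1 := by
  unfold fcond
  rw [integral_add ((integrableOn_pcond _).const_mul _) ((integrableOn_pcond _).const_mul _),
    integral_const_mul, integral_const_mul, integral_pcond, integral_pcond, mul_one, mul_one, hp]

lemma continuous_besselI0 : Continuous besselI0 := by
  refine continuous_iff_continuousAt.mpr fun t => ?_
  have h : ContinuousOn besselI0 (Metric.ball 0 (|t| + 1)) := by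
    unfold besselI0
    refine continuousOn_tsum (u := fun n => ((|t| + 1) ^ 2 / 4) ^ n / (Nat.factorial n : ℝ))
      (fun n => by fun_prop) (Real.summable_pow_div_factorial _) ?_
    intro n s hs
    rw [mem_ball_zero_iff, norm_eq_abs] at hs
    have h1 : (1 : ℝ) ≤ Nat.factorial n := by exact_mod_cast n.factorial_pos
    have h2 : s ^ 2 ≤ (|t| + 1) ^ 2 := by
      rw [← sq_abs s]; gcongr
    rw [norm_eq_abs, abs_of_nonneg (by positivity)]
    gcongr
    nlinarith
  exact h.continuousAt (Metric.isOpen_ball.mem_nhds (by simp))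

lemma continuous_EH (B h2 : ℝ) : Continuous (EH B h2) := by
  unfold EH
  exact continuous_besselI0.comp (by fun_prop)

section BoundedInput

variable {A1 A2 : ℝ} {F : Measure (ℝ × ℝ)}

lemma IsDistOn2.ae_mem (hF : IsDistOn2 A1 A2 F) :
    ∀ᵐ x ∂F, x ∈ Icc (0 : ℝ) A1 ×ˢ Icc (0 : ℝ) A2 := hF.2

lemma IsDistOn2.integrable_of_continuous (hF : IsDistOn2 A1 A2 F) {g : ℝ × ℝ → ℝ}
    (hg : Continuous g) : Integrable g F := by
  have := hF.1
  have h := hg.continuousOn.integrableOn_compact (μ := F)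
    ((isCompact_Icc (a := (0 : ℝ)) (b := A1)).prod (isCompact_Icc (a := (0 : ℝ)) (b := A2)))
  rwa [IntegrableOn, Measure.restrict_eq_self_of_ae_mem hF.ae_mem] at h

variable {p1 p2 c : ℝ}

lemma IsDistOn2.fout_mem_densityBand (hF : IsDistOn2 A1 A2 F)
    (hband : ∀ x ∈ Icc (0 : ℝ) A1 ×ˢ Icc (0 : ℝ) A2, ∀ y : ℝ, 0 < y →
      fcond p1 p2 x y ∈ densityBand c y) {y : ℝ} (hy : 0 < y) :
    fout p1 p2 F y ∈ densityBand c y := by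
  have := hF.1
  refine (convex_Icc _ _).integral_mem isClosed_Icc ?_ ?_
  · filter_upwards [hF.ae_mem] with x hx using hband x hx y hy
  · have hcont : Continuous fun x : ℝ × ℝ => fcond p1 p2 x y :=
      (continuous_fcond p1 p2).comp (g := fun z => fcond p1 p2 z.1 z.2)
        (f := fun x : ℝ × ℝ => (x, y)) (by fun_prop)
    exact hF.integrable_of_continuous hcont

lemma IsDistOn2.integrable_fcond_mul_log (hF : IsDistOn2 A1 A2 F) (hc : 0 < c)
    (hband : ∀ x ∈ Icc (0 : ℝ) A1 ×ˢ Icc (0 : ℝ) A2, ∀ y : ℝ, 0 < y →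
      fcond p1 p2 x y ∈ densityBand c y)
    {u v : (ℝ × ℝ) × ℝ → ℝ} (hu : Measurable u) (hv : Measurable v)
    (hub : ∀ x ∈ Icc (0 : ℝ) A1 ×ˢ Icc (0 : ℝ) A2, ∀ y : ℝ, 0 < y → u (x, y) ∈ densityBand c y)
    (hvb : ∀ x ∈ Icc (0 : ℝ) A1 ×ˢ Icc (0 : ℝ) A2, ∀ y : ℝ, 0 < y → v (x, y) ∈ densityBand c y) :
    Integrable (fun z : (ℝ × ℝ) × ℝ => fcond p1 p2 z.1 z.2 * log (u z / v z))
      (F.prod (volume.restrict (Ioi 0))) := by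
  have := hF.1
  refine ((integrableOn_bandEnvelope hc).integrable.comp_snd F).mono' ?_ ?_
  · exact ((continuous_fcond p1 p2).measurable.mul
      (measurable_log.comp (hu.div hv))).aestronglyMeasurable
  · filter_upwards [Measure.quasiMeasurePreserving_fst.ae hF.ae_mem,
      Measure.quasiMeasurePreserving_snd.ae (ae_restrict_mem measurableSet_Ioi)] with z hx hy
    have hf := hband z.1 hx z.2 hy
    rw [norm_mul, norm_eq_abs, norm_eq_abs, abs_of_pos (densityBand_pos hc hf)]
    exact mul_le_mul hf.2 (abs_log_div_le_of_mem_densityBand hc hy (hub z.1 hx z.2 hy)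
      (hvb z.1 hx z.2 hy)) (abs_nonneg _) (exp_pos _).le

lemma IsDistOn2.integrable_fcond (hF : IsDistOn2 A1 A2 F) (hc : 0 < c)
    (hband : ∀ x ∈ Icc (0 : ℝ) A1 ×ˢ Icc (0 : ℝ) A2, ∀ y : ℝ, 0 < y →
      fcond p1 p2 x y ∈ densityBand c y) :
    Integrable (fun z : (ℝ × ℝ) × ℝ => fcond p1 p2 z.1 z.2)
      (F.prod (volume.restrict (Ioi 0))) := by
  have := hF.1
  have hexp := (integrableOn_exp_mul_Ioi (neg_lt_zero.mpr hc) 0).integrable.comp_snd F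
  refine hexp.mono' (continuous_fcond p1 p2).measurable.aestronglyMeasurable ?_
  filter_upwards [Measure.quasiMeasurePreserving_fst.ae hF.ae_mem,
    Measure.quasiMeasurePreserving_snd.ae (ae_restrict_mem measurableSet_Ioi)] with z hx hy
  have hf := hband z.1 hx z.2 hy
  rw [norm_eq_abs, abs_of_pos (densityBand_pos hc hf), neg_mul]
  exact hf.2

lemma IsDistOn2.integrableOn_fout (hF : IsDistOn2 A1 A2 F) (hc : 0 < c)
    (hband : ∀ x ∈ Icc (0 : ℝ) A1 ×ˢ Icc (0 : ℝ) A2, ∀ y : ℝ, 0 < y →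
      fcond p1 p2 x y ∈ densityBand c y) : IntegrableOn (fout p1 p2 F) (Ioi 0) := by
  have := hF.1
  exact (hF.integrable_fcond hc hband).integral_prod_right

lemma IsDistOn2.integral_fout (hF : IsDistOn2 A1 A2 F) (hp : p1 + p2 = 1) (hc : 0 < c)
    (hband : ∀ x ∈ Icc (0 : ℝ) A1 ×ˢ Icc (0 : ℝ) A2, ∀ y : ℝ, 0 < y →
      fcond p1 p2 x y ∈ densityBand c y) : ∫ y in Ioi (0 : ℝ), fout p1 p2 F y = 1 := by
  have := hF.1
  have h := integral_integral_swap (f := fun x y => fcond p1 p2 x y)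
    (hF.integrable_fcond hc hband)
  simp only [integral_fcond hp, integral_const, probReal_univ, one_smul] at h
  exact h.symm

variable {G : Measure (ℝ × ℝ)}

lemma IsDistOn2.integrable_idens_integrand (hF : IsDistOn2 A1 A2 F) (hG : IsDistOn2 A1 A2 G)
    (hc : 0 < c)
    (hband : ∀ x ∈ Icc (0 : ℝ) A1 ×ˢ Icc (0 : ℝ) A2, ∀ y : ℝ, 0 < y →
      fcond p1 p2 x y ∈ densityBand c y) :
    Integrable (fun z : (ℝ × ℝ) × ℝ =>
      fcond p1 p2 z.1 z.2 * log (fcond p1 p2 z.1 z.2 / fout p1 p2 G z.2))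
      (F.prod (volume.restrict (Ioi 0))) := by
  have := hG.1
  exact hF.integrable_fcond_mul_log hc hband (continuous_fcond p1 p2).measurable
    ((measurable_fout p1 p2 G).comp measurable_snd) hband
    (fun x _ y hy => hG.fout_mem_densityBand hband hy)

lemma IsDistOn2.integrable_idens2 (hF : IsDistOn2 A1 A2 F) (hG : IsDistOn2 A1 A2 G)
    (hc : 0 < c)
    (hband : ∀ x ∈ Icc (0 : ℝ) A1 ×ˢ Icc (0 : ℝ) A2, ∀ y : ℝ, 0 < y →
      fcond p1 p2 x y ∈ densityBand c y) : Integrable (idens2 p1 p2 G) F :=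
  (hF.integrable_idens_integrand hG hc hband).integral_prod_left

/-- Nonnegativity of the relative entropy between the output densities of `F` and `G`. -/
lemma IsDistOn2.MI2_le_integral_idens2 (hF : IsDistOn2 A1 A2 F) (hG : IsDistOn2 A1 A2 G)
    (hp : p1 + p2 = 1) (hc : 0 < c)
    (hband : ∀ x ∈ Icc (0 : ℝ) A1 ×ˢ Icc (0 : ℝ) A2, ∀ y : ℝ, 0 < y →
      fcond p1 p2 x y ∈ densityBand c y) : MI2 p1 p2 F ≤ ∫ x, idens2 p1 p2 G x ∂F := by
  have := hF.1
  have := hG.1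
  have iF := hF.integrable_idens_integrand hF hc hband
  have iG := hF.integrable_idens_integrand hG hc hband
  have iL : Integrable (fun z : (ℝ × ℝ) × ℝ =>
      fcond p1 p2 z.1 z.2 * log (fout p1 p2 F z.2 / fout p1 p2 G z.2))
      (F.prod (volume.restrict (Ioi 0))) :=
    hF.integrable_fcond_mul_log hc hband
      ((measurable_fout p1 p2 F).comp measurable_snd)
      ((measurable_fout p1 p2 G).comp measurable_snd)
      (fun x _ y hy => hF.fout_mem_densityBand hband hy)
      (fun x _ y hy => hG.fout_mem_densityBand hband hy)
  have eF : MI2 p1 p2 F = _ := (integral_prod _ iF).symm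
  have eG : ∫ x, idens2 p1 p2 G x ∂F = _ := (integral_prod _ iG).symm
  have hdiff : ∫ x, idens2 p1 p2 G x ∂F - MI2 p1 p2 F =
      ∫ z, fcond p1 p2 z.1 z.2 * log (fout p1 p2 F z.2 / fout p1 p2 G z.2)
        ∂(F.prod (volume.restrict (Ioi 0))) := by
    rw [eF, eG, ← integral_sub iG iF]
    refine integral_congr_ae ?_
    filter_upwards [Measure.quasiMeasurePreserving_fst.ae hF.ae_mem,
      Measure.quasiMeasurePreserving_snd.ae (ae_restrict_mem measurableSet_Ioi)] with z hx hy
    have h1 := densityBand_pos hc (hband z.1 hx z.2 hy)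
    have h2 := densityBand_pos hc (hF.fout_mem_densityBand hband hy)
    have h3 := densityBand_pos hc (hG.fout_mem_densityBand hband hy)
    rw [log_div h1.ne' h2.ne', log_div h1.ne' h3.ne', log_div h2.ne' h3.ne']
    ring
  have hfub : ∫ z, fcond p1 p2 z.1 z.2 * log (fout p1 p2 F z.2 / fout p1 p2 G z.2)
        ∂(F.prod (volume.restrict (Ioi 0))) =
      ∫ y in Ioi (0 : ℝ), fout p1 p2 F y * log (fout p1 p2 F y / fout p1 p2 G y) := by
    rw [integral_prod_symm _ iL]
    simp only [integral_mul_const]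
    rfl
  have iFL : IntegrableOn
      (fun y => fout p1 p2 F y * log (fout p1 p2 F y / fout p1 p2 G y)) (Ioi 0) := by
    have h := iL.integral_prod_right
    simp only [integral_mul_const] at h
    exact h
  have iFout := hF.integrableOn_fout hc hband
  have iGout := hG.integrableOn_fout hc hband
  have hmono : ∫ y in Ioi (0 : ℝ), (fout p1 p2 F y - fout p1 p2 G y) ≤
      ∫ y in Ioi (0 : ℝ), fout p1 p2 F y * log (fout p1 p2 F y / fout p1 p2 G y) := by
    refine setIntegral_mono_on (iFout.sub iGout) iFL measurableSet_Ioi fun y hy => ?_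
    have h2 := densityBand_pos hc (hF.fout_mem_densityBand hband hy)
    have h3 := densityBand_pos hc (hG.fout_mem_densityBand hband hy)
    have h := mul_le_mul_of_nonneg_left (one_sub_inv_le_log_of_pos (div_pos h2 h3)) h2.le
    rwa [inv_div, mul_sub, mul_one, mul_div_cancel₀ _ h2.ne'] at h
  rw [integral_sub iFout iGout, hF.integral_fout hp hc hband, hG.integral_fout hp hc hband,
    sub_self] at hmono
  linarith

end BoundedInput

/-- (Time-varying peak-power, two states.) Let `F* ∈ Ω₂`. If there
exist `λ₁, λ₂ ≥ 0` such that for all `(x₁, x₂) ∈ [0,A₁]×[0,A₂]`,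
`λ₁(p₁x₁² + p₂x₂² − P) − λ₂(p₁ℰ(x₁) + p₂ℰ(x₂) − E_req) + I(F*) − i(x₁,x₂;F*) ≥ 0`,
with equality on the topological support of `F*`, then `F*` is optimal:
`I(F*) = sup_{F ∈ Ω₂} I(F)`. -/
theorem stmt6 (A1 A2 p1 p2 P B h2 Ereq : ℝ) (hA1 : 0 < A1) (hA2 : 0 < A2)
    (hp1 : 0 < p1) (hp2 : 0 < p2) (hp : p1 + p2 = 1)
    (hP : 0 < P) (hB : 0 < B) (hh2 : 0 < h2)
    (Fstar : Measure (ℝ × ℝ)) (hFstar : Feas2 A1 A2 p1 p2 P B h2 Ereq Fstar)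
    (l1 l2 : ℝ) (hl1 : 0 ≤ l1) (hl2 : 0 ≤ l2)
    (hineq : ∀ x ∈ Set.Icc (0 : ℝ) A1 ×ˢ Set.Icc (0 : ℝ) A2,
      0 ≤ l1 * (p1 * x.1 ^ 2 + p2 * x.2 ^ 2 - P)
          - l2 * (p1 * EH B h2 x.1 + p2 * EH B h2 x.2 - Ereq)
          + MI2 p1 p2 Fstar - idens2 p1 p2 Fstar x)
    (heq : ∀ x ∈ msupp Fstar,
      l1 * (p1 * x.1 ^ 2 + p2 * x.2 ^ 2 - P)
          - l2 * (p1 * EH B h2 x.1 + p2 * EH B h2 x.2 - Ereq)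
          + MI2 p1 p2 Fstar - idens2 p1 p2 Fstar x = 0) :
    MI2 p1 p2 Fstar = Cap2 A1 A2 p1 p2 P B h2 Ereq := by
  obtain ⟨c, hc, hband⟩ := exists_fcond_mem_densityBand A1 A2 hp1 hp2 hp
  suffices h : IsGreatest (MI2 p1 p2 '' {F | Feas2 A1 A2 p1 p2 P B h2 Ereq F})
      (MI2 p1 p2 Fstar) from h.csSup_eq.symm
  refine ⟨⟨Fstar, hFstar, rfl⟩, ?_⟩
  rintro _ ⟨F, ⟨hF, hpow, hener⟩, rfl⟩
  have := hF.1
  have hle := hF.MI2_le_integral_idens2 hFstar.1 hp hc hband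
  have hEH := continuous_EH B h2
  have ipow : Integrable (fun x : ℝ × ℝ => p1 * x.1 ^ 2 + p2 * x.2 ^ 2) F :=
    hF.integrable_of_continuous (by fun_prop)
  have iener : Integrable (fun x : ℝ × ℝ => p1 * EH B h2 x.1 + p2 * EH B h2 x.2) F :=
    hF.integrable_of_continuous (by fun_prop)
  have i1 : Integrable (fun x : ℝ × ℝ => l1 * (p1 * x.1 ^ 2 + p2 * x.2 ^ 2 - P)) F :=
    (ipow.sub (integrable_const P)).const_mul l1
  have i2 : Integrable
      (fun x : ℝ × ℝ => l2 * (p1 * EH B h2 x.1 + p2 * EH B h2 x.2 - Ereq)) F :=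
    (iener.sub (integrable_const Ereq)).const_mul l2
  have i12 : Integrable (fun x : ℝ × ℝ => l1 * (p1 * x.1 ^ 2 + p2 * x.2 ^ 2 - P)
      - l2 * (p1 * EH B h2 x.1 + p2 * EH B h2 x.2 - Ereq)) F := i1.sub i2
  have hbound : ∫ x, idens2 p1 p2 Fstar x ∂F ≤
      ∫ x : ℝ × ℝ, (l1 * (p1 * x.1 ^ 2 + p2 * x.2 ^ 2 - P)
        - l2 * (p1 * EH B h2 x.1 + p2 * EH B h2 x.2 - Ereq) + MI2 p1 p2 Fstar) ∂F := by
    refine integral_mono_ae (hF.integrable_idens2 hFstar.1 hc hband)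
      (i12.add (integrable_const _)) ?_
    filter_upwards [hF.ae_mem] with x hx
    exact sub_nonneg.mp (hineq x hx)
  have hval : ∫ x : ℝ × ℝ, (l1 * (p1 * x.1 ^ 2 + p2 * x.2 ^ 2 - P)
        - l2 * (p1 * EH B h2 x.1 + p2 * EH B h2 x.2 - Ereq) + MI2 p1 p2 Fstar) ∂F =
      l1 * ((∫ x : ℝ × ℝ, (p1 * x.1 ^ 2 + p2 * x.2 ^ 2) ∂F) - P)
        - l2 * ((∫ x : ℝ × ℝ, (p1 * EH B h2 x.1 + p2 * EH B h2 x.2) ∂F) - Ereq)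
        + MI2 p1 p2 Fstar := by
    rw [integral_add i12 (integrable_const _), integral_sub i1 i2, integral_const_mul,
      integral_const_mul, integral_sub ipow (integrable_const _),
      integral_sub iener (integrable_const _)]
    simp
  have t1 := mul_nonneg hl1 (sub_nonneg.mpr hpow)
  have t2 := mul_nonneg hl2 (sub_nonneg.mpr hener)
  linarith
end

section
/- The mutual-information functional F ↦ I(F) is continuous on the space of Borel probability measures on [0, A] equipped with the topology of weak convergence: if (Fₙ) converges weakly to F, then I(Fₙ) → I(F). -/
open MeasureTheory Real Set Filter

theorem pcond_pos (x y : ℝ) : 0 < pcond x y := by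
  unfold pcond; positivity

theorem pcond_le_one (x : ℝ) {y : ℝ} (hy : 0 ≤ y) : pcond x y ≤ 1 := by
  unfold pcond
  have h1 : 1 / (1 + x ^ 2) ≤ 1 := by
    rw [div_le_one (by positivity)]; nlinarith [sq_nonneg x]
  have h2 : Real.exp (-y / (1 + x ^ 2)) ≤ 1 := by
    rw [Real.exp_le_one_iff, neg_div]
    have : 0 ≤ y / (1 + x ^ 2) := by positivity
    linarith
  exact mul_le_one₀ h1 (Real.exp_pos _).le h2

theorem pcond_le_exp {A x y : ℝ} (hx : x ∈ Set.Icc 0 A) (hy : 0 ≤ y) :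
    pcond x y ≤ Real.exp (-(1 / (1 + A ^ 2)) * y) := by
  unfold pcond
  have hxA : x ^ 2 ≤ A ^ 2 := pow_le_pow_left₀ hx.1 hx.2 2
  have h1 : 1 / (1 + x ^ 2) ≤ 1 := by
    rw [div_le_one (by positivity)]; nlinarith [sq_nonneg x]
  have h3 : 1 / (1 + A ^ 2) ≤ 1 / (1 + x ^ 2) :=
    one_div_le_one_div_of_le (by positivity) (by linarith)
  have h2 : Real.exp (-y / (1 + x ^ 2)) ≤ Real.exp (-(1 / (1 + A ^ 2)) * y) := by
    rw [Real.exp_le_exp]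
    have := mul_le_mul_of_nonneg_right h3 hy
    have e : -y / (1 + x ^ 2) = -(1 / (1 + x ^ 2) * y) := by ring
    rw [e]; linarith
  calc _ ≤ 1 * Real.exp (-y / (1 + x ^ 2)) :=
        mul_le_mul_of_nonneg_right h1 (Real.exp_pos _).le
    _ ≤ _ := by rwa [one_mul]

theorem le_pcond {A x y : ℝ} (hx : x ∈ Set.Icc 0 A) (hy : 0 ≤ y) :
    1 / (1 + A ^ 2) * Real.exp (-y) ≤ pcond x y := by
  unfold pcond
  have hxA : x ^ 2 ≤ A ^ 2 := pow_le_pow_left₀ hx.1 hx.2 2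
  refine mul_le_mul (one_div_le_one_div_of_le (by positivity) (by linarith)) ?_
    (Real.exp_pos _).le (by positivity)
  rw [Real.exp_le_exp, le_div_iff₀ (by positivity)]
  nlinarith [mul_nonneg hy (sq_nonneg x)]

theorem continuous_pcond : Continuous (fun p : ℝ × ℝ => pcond p.1 p.2) := by
  unfold pcond
  have h : ∀ p : ℝ × ℝ, 1 + p.1 ^ 2 ≠ 0 := fun p => by positivity
  fun_prop (disch := exact h _)

theorem continuous_pcond_left (y : ℝ) : Continuous (fun x => pcond x y) :=
  continuous_pcond.comp (by fun_prop : Continuous fun x : ℝ => (x, y))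

theorem abs_log_le_of_mem {A y t : ℝ} (hl : 1 / (1 + A ^ 2) * Real.exp (-y) ≤ t) (hu : t ≤ 1) :
    |Real.log t| ≤ Real.log (1 + A ^ 2) + y := by
  have hp : 0 < 1 / (1 + A ^ 2) * Real.exp (-y) := by positivity
  have h := Real.log_le_log hp hl
  rw [Real.log_mul (by positivity) (by positivity), Real.log_exp, one_div, Real.log_inv] at h
  rw [abs_of_nonpos (Real.log_nonpos (hp.trans_le hl).le hu)]
  linarith

theorem IsDistOn.ae_mem {A : ℝ} {F : Measure ℝ} (h : IsDistOn A F) :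
    ∀ᵐ x ∂F, x ∈ Set.Icc 0 A := h.2

theorem integrable_pcond {A : ℝ} {F : Measure ℝ} (h : IsDistOn A F) {y : ℝ} (hy : 0 ≤ y) :
    Integrable (fun x => pcond x y) F := by
  have := h.1
  refine Integrable.of_bound (continuous_pcond_left y).aestronglyMeasurable 1 (.of_forall fun x => ?_)
  rw [Real.norm_of_nonneg (pcond_pos x y).le]
  exact pcond_le_one x hy

theorem pout_le_exp {A : ℝ} {F : Measure ℝ} (h : IsDistOn A F) {y : ℝ} (hy : 0 ≤ y) :
    pout F y ≤ Real.exp (-(1 / (1 + A ^ 2)) * y) := by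
  have := h.1
  simpa [pout] using integral_mono_ae (integrable_pcond h hy) (integrable_const _)
    (h.ae_mem.mono fun x hx => pcond_le_exp hx hy)

theorem pout_le_one {A : ℝ} {F : Measure ℝ} (h : IsDistOn A F) {y : ℝ} (hy : 0 ≤ y) :
    pout F y ≤ 1 := by
  have := h.1
  simpa [pout] using integral_mono_ae (integrable_pcond h hy) (integrable_const _)
    (.of_forall fun x => pcond_le_one x hy)

theorem le_pout {A : ℝ} {F : Measure ℝ} (h : IsDistOn A F) {y : ℝ} (hy : 0 ≤ y) :
    1 / (1 + A ^ 2) * Real.exp (-y) ≤ pout F y := by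
  have := h.1
  simpa [pout] using integral_mono_ae (integrable_const _) (integrable_pcond h hy)
    (h.ae_mem.mono fun x hx => le_pcond hx hy)

theorem pout_pos {A : ℝ} {F : Measure ℝ} (h : IsDistOn A F) {y : ℝ} (hy : 0 ≤ y) :
    0 < pout F y :=
  lt_of_lt_of_le (by positivity) (le_pout h hy)

/-- A dominating function in the output variable for the entropy-type integrands. -/
noncomputable def entropyBound (A y : ℝ) : ℝ :=
  Real.exp (-(1 / (1 + A ^ 2)) * y) * (Real.log (1 + A ^ 2) + y)

theorem integrableOn_entropyBound (A : ℝ) :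
    IntegrableOn (entropyBound A) (Set.Ioi 0) := by
  have hc : (0 : ℝ) < 1 / (1 + A ^ 2) := by positivity
  have h1 := (integrableOn_exp_mul_Ioi (neg_neg_iff_pos.2 hc) 0).const_mul (Real.log (1 + A ^ 2))
  have h2 := integrableOn_rpow_mul_exp_neg_mul_rpow (p := 1) (s := 1) (by norm_num) zero_lt_one hc
  refine (h1.add h2).congr (.of_forall fun y => ?_)
  simp only [entropyBound, Pi.add_apply, Real.rpow_one]
  ring

theorem abs_negMulLog_le_entropyBound {A y t : ℝ} (hl : 1 / (1 + A ^ 2) * Real.exp (-y) ≤ t)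
    (hu : t ≤ 1) (he : t ≤ Real.exp (-(1 / (1 + A ^ 2)) * y)) :
    |Real.negMulLog t| ≤ entropyBound A y := by
  have ht : 0 < t := lt_of_lt_of_le (by positivity) hl
  rw [Real.negMulLog, abs_mul, abs_neg, abs_of_pos ht]
  exact mul_le_mul he (abs_log_le_of_mem hl hu) (abs_nonneg _) (Real.exp_pos _).le

theorem abs_negMulLog_le_one {t : ℝ} (h0 : 0 ≤ t) (h1 : t ≤ 1) : |Real.negMulLog t| ≤ 1 := by
  rw [abs_of_nonneg (Real.negMulLog_nonneg h0 h1)]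
  have := Real.negMulLog_le_one_sub_self h0
  linarith

theorem integrable_negMulLog_pcond {A : ℝ} {F : Measure ℝ} (h : IsDistOn A F) {y : ℝ}
    (hy : 0 ≤ y) : Integrable (fun x => Real.negMulLog (pcond x y)) F := by
  have := h.1
  exact Integrable.of_bound
    (Real.continuous_negMulLog.comp (continuous_pcond_left y)).aestronglyMeasurable 1
    (.of_forall fun x => abs_negMulLog_le_one (pcond_pos x y).le (pcond_le_one x hy))

theorem measurable_pout (F : Measure ℝ) [SFinite F] : Measurable (pout F) :=
  (StronglyMeasurable.integral_prod_left'
    (f := fun p : ℝ × ℝ => pcond p.1 p.2) continuous_pcond.stronglyMeasurable).measurable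

theorem measurable_integral_negMulLog_pcond (F : Measure ℝ) [SFinite F] :
    Measurable (fun y => ∫ x, Real.negMulLog (pcond x y) ∂F) :=
  (StronglyMeasurable.integral_prod_left'
    (f := fun p : ℝ × ℝ => Real.negMulLog (pcond p.1 p.2))
    (Real.continuous_negMulLog.comp continuous_pcond).stronglyMeasurable).measurable

theorem integral_pcond_mul_log {A : ℝ} {F : Measure ℝ} (h : IsDistOn A F) {y : ℝ} (hy : 0 ≤ y) :
    ∫ x, pcond x y * Real.log (pcond x y / pout F y) ∂F =
      Real.negMulLog (pout F y) - ∫ x, Real.negMulLog (pcond x y) ∂F := by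
  have e : ∀ x, pcond x y * Real.log (pcond x y / pout F y) =
      pcond x y * (-Real.log (pout F y)) - Real.negMulLog (pcond x y) := fun x => by
    rw [Real.log_div (pcond_pos x y).ne' (pout_pos h hy).ne', Real.negMulLog]; ring
  simp_rw [e]
  rw [integral_sub ((integrable_pcond h hy).mul_const _) (integrable_negMulLog_pcond h hy),
    integral_mul_const, Real.negMulLog]
  change pout F y * _ - _ = _
  ring

theorem integrable_prod_pcond_mul_log {A : ℝ} {F : Measure ℝ} (h : IsDistOn A F) :
    Integrable (fun p : ℝ × ℝ => pcond p.1 p.2 * Real.log (pcond p.1 p.2 / pout F p.2))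
      (F.prod (volume.restrict (Set.Ioi 0))) := by
  have := h.1
  refine (((integrableOn_entropyBound A).integrable.const_mul 2).comp_snd F).mono' ?_ ?_
  · have h1 := continuous_pcond.measurable
    have h2 : Measurable fun p : ℝ × ℝ => pout F p.2 := (measurable_pout F).comp measurable_snd
    exact (h1.mul (Real.measurable_log.comp (h1.div h2))).aestronglyMeasurable
  · filter_upwards [Measure.quasiMeasurePreserving_fst.ae h.ae_mem,
      Measure.quasiMeasurePreserving_snd.ae (ae_restrict_mem measurableSet_Ioi)] with p hx hy
    have hy : 0 ≤ p.2 := le_of_lt hy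
    have hp := pcond_pos p.1 p.2
    rw [Real.log_div hp.ne' (pout_pos h hy).ne', Real.norm_eq_abs, abs_mul, abs_of_pos hp,
      entropyBound]
    have h1 := abs_log_le_of_mem (le_pcond hx hy) (pcond_le_one p.1 hy)
    have h2 := abs_log_le_of_mem (le_pout h hy) (pout_le_one h hy)
    have h3 := mul_le_mul (pcond_le_exp hx hy)
      ((abs_sub (Real.log (pcond p.1 p.2)) (Real.log (pout F p.2))).trans (add_le_add h1 h2))
      (abs_nonneg _) (Real.exp_pos _).le
    linarith

theorem MI_eq_integral_negMulLog {A : ℝ} {F : Measure ℝ} (h : IsDistOn A F) :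
    MI F = ∫ y in Set.Ioi (0 : ℝ),
      (Real.negMulLog (pout F y) - ∫ x, Real.negMulLog (pcond x y) ∂F) := by
  have := h.1
  unfold MI idens
  rw [integral_integral_swap (integrable_prod_pcond_mul_log h)]
  exact setIntegral_congr_fun measurableSet_Ioi
    fun y hy => integral_pcond_mul_log h (le_of_lt hy)

theorem abs_integral_negMulLog_pcond_le {A : ℝ} {F : Measure ℝ} (h : IsDistOn A F) {y : ℝ}
    (hy : 0 ≤ y) : |∫ x, Real.negMulLog (pcond x y) ∂F| ≤ entropyBound A y := by
  have := h.1
  have hb : ∀ᵐ x ∂F, ‖Real.negMulLog (pcond x y)‖ ≤ entropyBound A y := h.ae_mem.mono fun x hx =>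
    abs_negMulLog_le_entropyBound (le_pcond hx hy) (pcond_le_one x hy) (pcond_le_exp hx hy)
  simpa using norm_integral_le_of_norm_le_const hb

/-- Weak continuity of the mutual-information functional: if a
sequence `(Fₙ)` of Borel probability measures on `[0, A]` converges weakly to such a
measure `F` (i.e. integrals of every bounded continuous function converge), then
`I(Fₙ) → I(F)`. -/
theorem stmt9 (A : ℝ) (hA : 0 < A)
    (F : ℕ → Measure ℝ) (Flim : Measure ℝ)
    (hF : ∀ n, IsDistOn A (F n)) (hFlim : IsDistOn A Flim)
    (hconv : ∀ g : BoundedContinuousFunction ℝ ℝ,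
      Filter.Tendsto (fun n => ∫ x, g x ∂(F n)) Filter.atTop (nhds (∫ x, g x ∂Flim))) :
    Filter.Tendsto (fun n => MI (F n)) Filter.atTop (nhds (MI Flim)) := by
  rw [MI_eq_integral_negMulLog hFlim]
  simp_rw [fun n => MI_eq_integral_negMulLog (hF n)]
  refine tendsto_integral_of_dominated_convergence (fun y => 2 * entropyBound A y) (fun n => ?_)
    ((integrableOn_entropyBound A).integrable.const_mul 2) (fun n => ?_) ?_
  · have := (hF n).1
    exact ((Real.continuous_negMulLog.measurable.comp (measurable_pout (F n))).sub
      (measurable_integral_negMulLog_pcond (F n))).aestronglyMeasurable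
  · filter_upwards [ae_restrict_mem measurableSet_Ioi] with y hy
    have hy : 0 ≤ y := le_of_lt hy
    have h1 := abs_negMulLog_le_entropyBound (le_pout (hF n) hy) (pout_le_one (hF n) hy)
      (pout_le_exp (hF n) hy)
    have h2 := abs_integral_negMulLog_pcond_le (hF n) hy
    rw [Real.norm_eq_abs]
    refine (abs_sub _ _).trans ?_
    linarith
  · filter_upwards [ae_restrict_mem measurableSet_Ioi] with y hy
    have hy : 0 ≤ y := le_of_lt hy
    have h1 := hconv (BoundedContinuousFunction.ofNormedAddCommGroup _
      (continuous_pcond_left y) 1 fun x => by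
        rw [Real.norm_of_nonneg (pcond_pos x y).le]; exact pcond_le_one x hy)
    have h2 := hconv (BoundedContinuousFunction.ofNormedAddCommGroup _
      (Real.continuous_negMulLog.comp (continuous_pcond_left y)) 1 fun x =>
        abs_negMulLog_le_one (pcond_pos x y).le (pcond_le_one x hy))
    exact ((Real.continuous_negMulLog.tendsto _).comp h1).sub h2
end

section
/- For every s > 0, the unilateral Laplace transform of the logarithm satisfies ∫₀^∞ e^{−s·y}·log y dy = −(γ + log s)/s, where γ is the Euler–Mascheroni constant. -/
open MeasureTheory Real Set

/-- The integral of `e^{-y} log y` over the positive half-line is `-γ`. -/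
theorem integral_exp_neg_mul_log_Ioi :
    ∫ y in Ioi (0 : ℝ), exp (-y) * log y = -eulerMascheroniConstant := by
  have hΓ : HasDerivAt Complex.Gamma
      (∫ t : ℝ in Ioi 0, (t : ℂ) ^ ((1 : ℂ) - 1) * (log t * exp (-t))) 1 := by
    refine (Complex.hasDerivAt_GammaIntegral (s := 1) (by simp)).congr_of_eventuallyEq ?_
    have : IsOpen {s : ℂ | 0 < s.re} := Complex.continuous_re.isOpen_preimage _ isOpen_Ioi
    filter_upwards [this.mem_nhds (show 0 < (1 : ℂ).re by simp)] with a ha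
    exact Complex.Gamma_eq_integral ha
  have h := hΓ.unique Complex.hasDerivAt_Gamma_one
  simp only [sub_self, Complex.cpow_zero, one_mul, ← Complex.ofReal_mul] at h
  rw [integral_complex_ofReal] at h
  simp_rw [mul_comm (exp _)]
  exact_mod_cast h

/-- The function `e^{-y} log y` is integrable on the positive half-line. -/
theorem integrableOn_exp_neg_mul_log_Ioi :
    IntegrableOn (fun y : ℝ => exp (-y) * log y) (Ioi 0) := by
  refine not_imp_comm.1 integral_undef ?_
  rw [integral_exp_neg_mul_log_Ioi]
  linarith [one_half_lt_eulerMascheroniConstant]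

/-- For every `s > 0`, the unilateral Laplace transform of the
logarithm satisfies `∫₀^∞ e^{−s·y}·log y dy = −(γ + log s)/s`, where `γ` is the
Euler–Mascheroni constant. -/
theorem stmt16 (s : ℝ) (hs : 0 < s) :
    (∫ y in Set.Ioi (0 : ℝ), Real.exp (-s * y) * Real.log y) =
      -(Real.eulerMascheroniConstant + Real.log s) / s := by
  have hscale : ∀ y ∈ Ioi (0 : ℝ), exp (-s * y) * log y =
      exp (-(s * y)) * log (s * y) - exp (-(s * y)) * log s := by
    intro y hy
    rw [log_mul hs.ne' (ne_of_gt hy), neg_mul]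
    ring
  rw [setIntegral_congr_fun measurableSet_Ioi hscale,
    integral_comp_mul_left_Ioi (fun u => exp (-u) * log u - exp (-u) * log s) 0 hs, mul_zero,
    integral_sub integrableOn_exp_neg_mul_log_Ioi
      ((integrableOn_exp_neg_Ioi 0).mul_const _),
    integral_exp_neg_mul_log_Ioi, integral_mul_const, integral_exp_neg_Ioi_zero, smul_eq_mul]
  field_simp
  ring
end
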